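/- arXiv:1102.2223 — 3 statements merged into one kernel-verified Lean document; each statement's English description precedes it below -/
import Mathlib

section
/- Let N ≥ 2 be an integer such that either 2 does not divide N or 4 divides N, and let f₁, f₂ be integers. Then the map x ↦ f₁x + f₂x² is a bijection of ℤ_N if and only if gcd(f₁, N) = 1 and every prime p dividing N also divides f₂. -/
/-- Injectivity of `x ↦ f₁ x + f₂ x²` on `ℤ_d`, in terms of integer divisibility. -/
theorem injective_quadratic_zmod_iff (d : ℕ) (f₁ f₂ : ℤ) :
    Function.Injective (fun x : ZMod d => (f₁ : ZMod d) * x + (f₂ : ZMod d) * x ^ 2) ↔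
      ∀ a b : ℤ, (d : ℤ) ∣ (a - b) * (f₁ + f₂ * (a + b)) → (d : ℤ) ∣ a - b := by
  constructor
  · intro h a b hab
    rw [← ZMod.intCast_zmod_eq_zero_iff_dvd] at hab ⊢
    push_cast at hab ⊢
    refine sub_eq_zero.2 (h ?_)
    linear_combination hab
  · intro h x y hxy
    obtain ⟨a, rfl⟩ := ZMod.intCast_surjective x
    obtain ⟨b, rfl⟩ := ZMod.intCast_surjective y
    have := h a b
    rw [← ZMod.intCast_zmod_eq_zero_iff_dvd, ← ZMod.intCast_zmod_eq_zero_iff_dvd] at this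
    push_cast at this
    refine sub_eq_zero.1 (this ?_)
    linear_combination hxy

/-- A quadratic map that is onto `ℤ_N` is injective on `ℤ_d` for every divisor `d` of `N`. -/
theorem injective_quadratic_zmod_of_dvd {N d : ℕ} [NeZero d] (hd : d ∣ N) (f₁ f₂ : ℤ)
    (h : Function.Surjective
      (fun x : ZMod N => (f₁ : ZMod N) * x + (f₂ : ZMod N) * x ^ 2)) :
    Function.Injective (fun x : ZMod d => (f₁ : ZMod d) * x + (f₂ : ZMod d) * x ^ 2) := by
  refine Finite.injective_iff_surjective.2 fun y => ?_
  obtain ⟨b, rfl⟩ := ZMod.intCast_surjective y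
  obtain ⟨x, hx⟩ := h b
  refine ⟨ZMod.castHom hd (ZMod d) x, ?_⟩
  simpa only [map_add, map_mul, map_pow, map_intCast] using
    congrArg (ZMod.castHom hd (ZMod d)) hx

/-- Let `N ≥ 2` with either `2 ∤ N` or `4 ∣ N`. The map
`x ↦ f₁ x + f₂ x²` is a bijection of `ℤ_N` iff `gcd(f₁, N) = 1` and every prime
dividing `N` also divides `f₂`. -/
theorem qpp_criterion_case2 (N : ℕ) (hN : 2 ≤ N) (hcase : ¬ (2 ∣ N) ∨ 4 ∣ N)
    (f₁ f₂ : ℤ) :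
    Function.Bijective (fun x : ZMod N => (f₁ : ZMod N) * x + (f₂ : ZMod N) * x ^ 2) ↔
      (Int.gcd f₁ (N : ℤ) = 1 ∧ ∀ p : ℕ, p.Prime → p ∣ N → (p : ℤ) ∣ f₂) := by
  have : NeZero N := ⟨by lia⟩
  constructor
  · intro h
    have key : ∀ d : ℕ, d ≠ 0 → d ∣ N → ∀ a b : ℤ,
        (d : ℤ) ∣ (a - b) * (f₁ + f₂ * (a + b)) → (d : ℤ) ∣ a - b := fun d hd0 hd =>
      have : NeZero d := ⟨hd0⟩
      (injective_quadratic_zmod_iff d f₁ f₂).1 (injective_quadratic_zmod_of_dvd hd f₁ f₂ h.2)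
    have dvd_f₂ : ∀ p : ℕ, p.Prime → p ∣ N → (p : ℤ) ∣ f₂ := by
      intro p hp hpN
      by_contra hf₂
      have hcop : IsCoprime (p : ℤ) f₂ :=
        (Nat.prime_iff_prime_int.1 hp).coprime_iff_not_dvd.2 hf₂
      obtain ⟨v, u, huv⟩ := hcop
      have h0 := key p hp.ne_zero hpN 0 (-f₁ * u)
        (Dvd.dvd.mul_left ⟨f₁ * v, by linear_combination (-f₁) * huv⟩ _)
      have h1 := key p hp.ne_zero hpN 1 (-f₁ * u - 1)
        (Dvd.dvd.mul_left ⟨f₁ * v, by linear_combination (-f₁) * huv⟩ _)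
      have h2 : (p : ℤ) ∣ 2 := by
        have := dvd_sub h1 h0
        ring_nf at this
        exact this
      have hp2 : p = 2 := (Nat.prime_dvd_prime_iff_eq hp Nat.prime_two).1 (by exact_mod_cast h2)
      subst hp2
      have h4 : 4 ∣ N := hcase.resolve_left (not_not.2 hpN)
      have hf₁ : (2 : ℤ) ∣ f₁ := by
        by_contra hf₁
        have := key 2 two_ne_zero hpN 1 0 (by push_cast at hf₂ ⊢; lia)
        norm_num at this
      have := key 4 four_ne_zero h4 2 0 (by push_cast; lia)
      norm_num at this
    refine ⟨?_, dvd_f₂⟩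
    by_contra hg
    obtain ⟨p, hp, hpg⟩ := Nat.exists_prime_and_dvd hg
    have hpf₁ : (p : ℤ) ∣ f₁ := (Int.natCast_dvd_natCast.2 hpg).trans (Int.gcd_dvd_left _ _)
    have hpN : p ∣ N := Int.natCast_dvd_natCast.1
      ((Int.natCast_dvd_natCast.2 hpg).trans (Int.gcd_dvd_right _ _))
    have := key p hp.ne_zero hpN 1 0
      (Dvd.dvd.mul_left (dvd_add hpf₁ ((dvd_f₂ p hp hpN).mul_right _)) _)
    exact (Nat.prime_iff_prime_int.1 hp).not_dvd_one (by simpa using this)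
  · rintro ⟨hg, hf₂⟩
    refine Finite.injective_iff_bijective.1 ((injective_quadratic_zmod_iff N f₁ f₂).2 ?_)
    intro a b hab
    refine Int.dvd_of_dvd_mul_left_of_gcd_one hab ?_
    by_contra hg'
    obtain ⟨p, hp, hpg⟩ := Nat.exists_prime_and_dvd hg'
    have hpN : (p : ℤ) ∣ N := (Int.natCast_dvd_natCast.2 hpg).trans (Int.gcd_dvd_left _ _)
    have hps : (p : ℤ) ∣ f₁ + f₂ * (a + b) :=
      (Int.natCast_dvd_natCast.2 hpg).trans (Int.gcd_dvd_right _ _)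
    have hpf₁ : (p : ℤ) ∣ f₁ :=
      (dvd_add_left ((hf₂ p hp (Int.natCast_dvd_natCast.1 hpN)).mul_right _)).1 hps
    have := Int.dvd_coe_gcd hpf₁ hpN
    rw [hg] at this
    exact (Nat.prime_iff_prime_int.1 hp).not_dvd_one (by simpa using this)
end

section
/- Let N ≥ 2 be an integer with N ≡ 2 (mod 4), and let f₁, f₂ be integers. Then the map x ↦ f₁x + f₂x² is a bijection of ℤ_N if and only if f₁ + f₂ is odd, gcd(f₁, N/2) = 1, and every odd prime p dividing N also divides f₂. -/
/-- A quadratic map that is bijective on `ZMod N` is injective on `ZMod d` for every `d ∣ N`. -/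
theorem quadratic_injective_of_dvd {N d : ℕ} [NeZero d] (hd : d ∣ N) {f₁ f₂ : ℤ}
    (h : Function.Bijective
      (fun x : ZMod N => (f₁ : ZMod N) * x + (f₂ : ZMod N) * x ^ 2)) :
    Function.Injective (fun x : ZMod d => (f₁ : ZMod d) * x + (f₂ : ZMod d) * x ^ 2) := by
  refine Finite.injective_iff_surjective.mpr fun y => ?_
  obtain ⟨z, rfl⟩ := ZMod.castHom_surjective hd y
  obtain ⟨x, rfl⟩ := h.2 z
  exact ⟨ZMod.castHom hd (ZMod d) x, by simp only [map_add, map_mul, map_pow, map_intCast]⟩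

/-- If a quadratic map is injective modulo an odd prime `p`, then `p` divides the quadratic
coefficient but not the linear one. -/
theorem dvd_and_not_dvd_of_quadratic_injective {p : ℕ} [Fact p.Prime] (hp2 : p ≠ 2) {f₁ f₂ : ℤ}
    (h : Function.Injective
      (fun x : ZMod p => (f₁ : ZMod p) * x + (f₂ : ZMod p) * x ^ 2)) :
    (p : ℤ) ∣ f₂ ∧ ¬ (p : ℤ) ∣ f₁ := by
  simp only [← ZMod.intCast_zmod_eq_zero_iff_dvd]
  have h₂ : (f₂ : ZMod p) = 0 := by
    by_contra hf₂
    have hroot : -(f₁ : ZMod p) / f₂ = 0 := h (by field_simp; ring)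
    have hf₁ : (f₁ : ZMod p) = 0 := by simpa [hf₂] using hroot
    have : Fact (2 < p) := ⟨lt_of_le_of_ne (Fact.out : p.Prime).two_le hp2.symm⟩
    exact ZMod.neg_one_ne_one (n := p) (h (by simp [hf₁]))
  refine ⟨h₂, fun h₁ => ?_⟩
  exact zero_ne_one (α := ZMod p) (h (by simp [h₁, h₂]))

/-- Let `N ≥ 2` with `N ≡ 2 (mod 4)`. The map `x ↦ f₁ x + f₂ x²` is a
bijection of `ℤ_N` iff `f₁ + f₂` is odd, `gcd(f₁, N/2) = 1`, and every odd prime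
dividing `N` also divides `f₂`. -/
theorem qpp_criterion_case1 (N : ℕ) (hN : 2 ≤ N) (hcase : N % 4 = 2) (f₁ f₂ : ℤ) :
    Function.Bijective (fun x : ZMod N => (f₁ : ZMod N) * x + (f₂ : ZMod N) * x ^ 2) ↔
      (Odd (f₁ + f₂) ∧ Int.gcd f₁ ((N / 2 : ℕ) : ℤ) = 1 ∧
        ∀ p : ℕ, p.Prime → p ≠ 2 → p ∣ N → (p : ℤ) ∣ f₂) := by
  have : NeZero N := ⟨by omega⟩
  obtain ⟨M, rfl⟩ : ∃ M, N = 2 * M := ⟨N / 2, by omega⟩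
  have hM : M % 2 = 1 := by omega
  rw [Nat.mul_div_cancel_left M two_pos]
  have ne_two {p : ℕ} (hpM : p ∣ M) : p ≠ 2 := by rintro rfl; omega
  constructor
  · intro h
    refine ⟨?_, ?_, ?_⟩
    · rw [← Int.not_even_iff_odd, even_iff_two_dvd]
      intro h2
      have h0 : ((f₁ + f₂ : ℤ) : ZMod 2) = 0 :=
        (ZMod.intCast_zmod_eq_zero_iff_dvd _ 2).mpr (by exact_mod_cast h2)
      exact zero_ne_one (α := ZMod 2)
        (quadratic_injective_of_dvd (dvd_mul_right 2 M) h (by push_cast at h0; simp [h0]))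
    · by_contra hg
      obtain ⟨p, hp, hpg⟩ := Nat.exists_prime_and_dvd hg
      have : Fact p.Prime := ⟨hp⟩
      have hpM : p ∣ M := by
        exact_mod_cast (Int.natCast_dvd_natCast.mpr hpg).trans (Int.gcd_dvd_right f₁ (M : ℤ))
      exact (dvd_and_not_dvd_of_quadratic_injective (ne_two hpM)
        (quadratic_injective_of_dvd (hpM.mul_left 2) h)).2
        ((Int.natCast_dvd_natCast.mpr hpg).trans (Int.gcd_dvd_left f₁ (M : ℤ)))
    · intro p hp hp2 hpN
      have : Fact p.Prime := ⟨hp⟩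
      exact (dvd_and_not_dvd_of_quadratic_injective hp2 (quadratic_injective_of_dvd hpN h)).1
  · rintro ⟨hodd, hgcd, hdvd⟩
    refine Finite.injective_iff_bijective.mp fun x y hxy => ?_
    obtain ⟨a, rfl⟩ := ZMod.intCast_surjective x
    obtain ⟨b, rfl⟩ := ZMod.intCast_surjective y
    have hprod : ((2 * M : ℕ) : ℤ) ∣ (f₁ + f₂ * (a + b)) * (a - b) := by
      rw [← ZMod.intCast_zmod_eq_zero_iff_dvd]
      push_cast at hxy ⊢
      linear_combination hxy
    push_cast at hprod
    have hcop : IsCoprime (M : ℤ) (f₁ + f₂ * (a + b)) := by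
      rw [Int.isCoprime_iff_gcd_eq_one]
      by_contra hg
      obtain ⟨p, hp, hpg⟩ := Nat.exists_prime_and_dvd hg
      have hpg' := Int.natCast_dvd_natCast.mpr hpg
      have hpM := hpg'.trans (Int.gcd_dvd_left _ _)
      have hpM' : p ∣ M := Int.natCast_dvd_natCast.mp hpM
      have hpf₂ := hdvd p hp (ne_two hpM') (hpM'.mul_left 2)
      have hpf₁ : (p : ℤ) ∣ f₁ :=
        (dvd_add_left (hpf₂.mul_right _)).mp (hpg'.trans (Int.gcd_dvd_right _ _))
      have := Int.dvd_coe_gcd hpf₁ hpM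
      rw [hgcd] at this
      exact hp.one_lt.ne' (Nat.dvd_one.mp (Int.natCast_dvd_natCast.mp this))
    have hMab : (M : ℤ) ∣ a - b := hcop.dvd_of_dvd_mul_left ((dvd_mul_left _ _).trans hprod)
    have h2ab : (2 : ℤ) ∣ a - b := by
      have heven := (dvd_mul_right _ _).trans hprod
      rw [← even_iff_two_dvd] at heven ⊢
      simp only [Int.even_mul, Int.even_add, Int.even_sub, ← Int.not_even_iff_odd] at *
      tauto
    have hcop2 : IsCoprime (2 : ℤ) M := by
      exact_mod_cast Nat.isCoprime_iff_coprime.mpr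
        (Nat.coprime_two_left.mpr (Nat.odd_iff.mpr hM))
    have hab := hcop2.mul_dvd h2ab hMab
    rw [← sub_eq_zero, ← Int.cast_sub, ZMod.intCast_zmod_eq_zero_iff_dvd]
    exact_mod_cast hab
end

section
/- Let f(X) = f₁·X + f₂·X² be a polynomial with integer coefficients, and let f^{(n)} denote the n-fold composition of f with itself (f^{(1)} = f, f^{(n+1)} = f ∘ f^{(n)}). Then for every n ≥ 1 and every k ≥ 1, the coefficient of X^k in f^{(n)} is divisible by f₂^{k−1}. -/
open Polynomial

/-- Composing a quadratic polynomial without constant term and with leading coefficient `b` on the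
left preserves the property that the coefficient of `X ^ k` is divisible by `b ^ (k - 1)`. -/
theorem pow_pred_dvd_coeff_quadratic_comp {R : Type*} [CommSemiring R] (a b : R) {p : R[X]}
    (hp : ∀ k, b ^ (k - 1) ∣ p.coeff k) (k : ℕ) :
    b ^ (k - 1) ∣ ((C a * X + C b * X ^ 2).comp p).coeff k := by
  simp only [add_comp, mul_comp, C_comp, X_comp, X_pow_comp, coeff_add, coeff_C_mul]
  refine dvd_add ((hp k).mul_left a) ?_
  rw [sq, coeff_mul, Finset.mul_sum]
  refine Finset.dvd_sum fun ij hij => ?_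
  have hk : ij.1 + ij.2 = k := Finset.HasAntidiagonal.mem_antidiagonal.mp hij
  calc b ^ (k - 1) ∣ b ^ (1 + ((ij.1 - 1) + (ij.2 - 1))) := pow_dvd_pow b (by omega)
    _ = b * (b ^ (ij.1 - 1) * b ^ (ij.2 - 1)) := by rw [pow_add, pow_add, pow_one]
    _ ∣ b * (p.coeff ij.1 * p.coeff ij.2) := mul_dvd_mul_left b (mul_dvd_mul (hp _) (hp _))

/-- For `f(X) = f₁ X + f₂ X² ∈ ℤ[X]`, the coefficient of `X^k` in the
`n`-fold composition `f^{(n)}` is divisible by `f₂^(k-1)` for all `n ≥ 1`, `k ≥ 1`.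
Here `f^{(n)} = (p ↦ f ∘ p)^[n] X`, so that `f^{(1)} = f` and
`f^{(n+1)} = f ∘ f^{(n)}`. -/
theorem coeff_iterate_comp_dvd (f₁ f₂ : ℤ) :
    ∀ n : ℕ, 1 ≤ n → ∀ k : ℕ, 1 ≤ k →
      f₂ ^ (k - 1) ∣
        (((fun p : Polynomial ℤ => (C f₁ * X + C f₂ * X ^ 2).comp p)^[n]) X).coeff k := by
  suffices h : ∀ n k : ℕ, f₂ ^ (k - 1) ∣
      (((fun p : Polynomial ℤ => (C f₁ * X + C f₂ * X ^ 2).comp p)^[n]) X).coeff k from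
    fun n _ k _ => h n k
  intro n
  induction n with
  | zero =>
    intro k
    rw [Function.iterate_zero_apply, coeff_X]
    split_ifs with hk
    · simp [← hk]
    · exact dvd_zero _
  | succ n ih =>
    intro k
    rw [Function.iterate_succ_apply']
    exact pow_pred_dvd_coeff_quadratic_comp f₁ f₂ ih k
end
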